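/- arXiv:1203.1557 — 2 statements merged into one kernel-verified Lean document; each statement's English description precedes it below -/
import Mathlib

section
/- For every positive integer n, the sum over k from 1 to n of H_k/(k(k+1)(k+2)) equals (1/2)·H_{n+1}^{(2)} − H_{n+1}/(2(n+1)(n+2)) − (n+1)/(2(n+2)). -/
/-- The `n`-th harmonic number `H_n = ∑_{k=1}^n 1/k`, with `H_0 = 0`. -/
def H (n : ℕ) : ℚ := ∑ k ∈ Finset.range n, 1 / ((k : ℚ) + 1)

/-- The generalized harmonic number of order 2, `H_n^{(2)} = ∑_{k=1}^n 1/k^2`, with `H_0^{(2)} = 0`. -/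
def H2 (n : ℕ) : ℚ := ∑ k ∈ Finset.range n, 1 / ((k : ℚ) + 1) ^ 2

theorem H_succ (n : ℕ) : H (n + 1) = H n + 1 / ((n : ℚ) + 1) :=
  Finset.sum_range_succ _ n

theorem H2_succ (n : ℕ) : H2 (n + 1) = H2 n + 1 / ((n : ℚ) + 1) ^ 2 :=
  Finset.sum_range_succ _ n

theorem stmt_10 (n : ℕ) (hn : 0 < n) :
    ∑ k ∈ Finset.Icc 1 n, H k / ((k : ℚ) * ((k : ℚ) + 1) * ((k : ℚ) + 2)) =
      (1 / 2) * H2 (n + 1) - H (n + 1) / (2 * ((n : ℚ) + 1) * ((n : ℚ) + 2))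
        - ((n : ℚ) + 1) / (2 * ((n : ℚ) + 2)) := by
  clear hn
  induction n with
  | zero => norm_num [H, H2]
  | succ n ih =>
    have h1 : (n : ℚ) + 1 ≠ 0 := by positivity
    have h2 : (n : ℚ) + 2 ≠ 0 := by positivity
    have h3 : (n : ℚ) + 3 ≠ 0 := by positivity
    have e2 : (n : ℚ) + 1 + 1 = n + 2 := by ring
    have e3 : (n : ℚ) + 1 + 2 = n + 3 := by ring
    rw [Finset.sum_Icc_succ_top (by lia), ih, H_succ (n + 1), H2_succ (n + 1)]
    push_cast
    rw [e2, e3]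
    field_simp
    ring
end

section
/- For every nonnegative integer n, the sum over k from 0 to n of H_{n−k}/(k+2) equals H_{n+1}^2 − H_{n+1}^{(2)} − (n/(n+2))·H_{n+1}. -/
theorem sum_range_one_div_reflect (n : ℕ) :
    ∑ k ∈ Finset.range n, 1 / (((n - 1 - k : ℕ) : ℚ) + 1) = H n :=
  Finset.sum_range_reflect (fun k : ℕ => 1 / ((k : ℚ) + 1)) n

theorem sum_range_one_div_mul_reflect (n : ℕ) :
    ∑ k ∈ Finset.range (n + 1), 1 / (((n - k : ℕ) : ℚ) + 1) / ((k : ℚ) + 1) =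
      2 * H (n + 1) / ((n : ℚ) + 2) := by
  have partial_fractions : ∀ k ∈ Finset.range (n + 1),
      1 / (((n - k : ℕ) : ℚ) + 1) / ((k : ℚ) + 1) =
        (1 / (((n + 1 - 1 - k : ℕ) : ℚ) + 1) + 1 / ((k : ℚ) + 1)) / ((n : ℚ) + 2) := by
    intro k hk
    obtain ⟨m, rfl⟩ := Nat.exists_eq_add_of_le (Nat.lt_succ_iff.mp (Finset.mem_range.mp hk))
    simp only [Nat.add_sub_cancel, Nat.add_sub_cancel_left]
    push_cast
    have hm : (m : ℚ) + 1 ≠ 0 := by positivity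
    have hk' : (k : ℚ) + 1 ≠ 0 := by positivity
    have hs : (k : ℚ) + m + 2 ≠ 0 := by positivity
    field_simp
    ring
  rw [Finset.sum_congr rfl partial_fractions, ← Finset.sum_div, Finset.sum_add_distrib,
    sum_range_one_div_reflect, two_mul]
  rfl

theorem sum_range_H_div (n : ℕ) :
    ∑ k ∈ Finset.range (n + 1), H (n - k) / ((k : ℚ) + 1) = H (n + 1) ^ 2 - H2 (n + 1) := by
  induction n with
  | zero => norm_num [H, H2]
  | succ n ih =>
    have step : ∀ k ∈ Finset.range (n + 1), H (n + 1 - k) / ((k : ℚ) + 1) =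
        H (n - k) / ((k : ℚ) + 1) + 1 / (((n - k : ℕ) : ℚ) + 1) / ((k : ℚ) + 1) := by
      intro k hk
      rw [Nat.succ_sub (Nat.lt_succ_iff.mp (Finset.mem_range.mp hk)), Nat.succ_eq_add_one,
        H_succ, add_div]
    have H_zero : H 0 = 0 := Finset.sum_range_zero _
    rw [Finset.sum_range_succ, Finset.sum_congr rfl step, Finset.sum_add_distrib, ih,
      sum_range_one_div_mul_reflect, Nat.sub_self, H_zero, H_succ (n + 1), H2_succ (n + 1)]
    push_cast
    have hn : (n : ℚ) + 1 + 1 ≠ 0 := by positivity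
    have hn' : (n : ℚ) + 2 ≠ 0 := by positivity
    field_simp
    ring

theorem stmt_13 (n : ℕ) :
    ∑ k ∈ Finset.range (n + 1), H (n - k) / ((k : ℚ) + 2) =
      H (n + 1) ^ 2 - H2 (n + 1) - ((n : ℚ) / ((n : ℚ) + 2)) * H (n + 1) := by
  have h := sum_range_H_div (n + 1)
  rw [Finset.sum_range_succ', H_succ (n + 1), H2_succ (n + 1)] at h
  have shift : ∀ k ∈ Finset.range (n + 1),
      H (n + 1 - (k + 1)) / (((k + 1 : ℕ) : ℚ) + 1) = H (n - k) / ((k : ℚ) + 2) := by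
    intro k _
    rw [Nat.add_sub_add_right]
    push_cast
    ring
  rw [Finset.sum_congr rfl shift] at h
  rw [eq_sub_of_add_eq h, Nat.sub_zero]
  push_cast
  have hn : (n : ℚ) + 1 + 1 ≠ 0 := by positivity
  have hn' : (n : ℚ) + 2 ≠ 0 := by positivity
  field_simp
  ring
end
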